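/- arXiv:1610.05202 — 7 statements merged into one kernel-verified Lean document; each statement's English description precedes it below -/
import Mathlib

section
/- The matrix I − ᾱ(I − C) − αP ∈ ℝ^{n×n} is invertible, and the unique global minimizer of Q_mp over ℝ^{n×p} is Θ* = ᾱ (I − ᾱ(I − C) − αP)⁻¹ C Θ^loc. -/
open Matrix Finset

/-- The sum of a symmetric function vanishing on the diagonal over the pairs `i < j` is half of its
sum over all pairs. -/
theorem sum_lt_eq_half_sum {ι : Type*} [Fintype ι] [LinearOrder ι] (f : ι → ι → ℝ)
    (hsymm : ∀ i j, f i j = f j i) (hdiag : ∀ i, f i i = 0) :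
    (∑ i, ∑ j, if i < j then f i j else 0) = (1 / 2) * ∑ i, ∑ j, f i j := by
  have hsplit : ∀ i j, f i j = (if i < j then f i j else 0) + (if j < i then f j i else 0) := by
    intro i j
    rcases lt_trichotomy i j with h | rfl | h
    · simp [h, h.not_gt]
    · simp [hdiag]
    · simp [h, h.not_gt, hsymm i j]
  have hsum : ∑ i, ∑ j, f i j = (∑ i, ∑ j, if i < j then f i j else 0)
      + ∑ i, ∑ j, if j < i then f j i else 0 := by
    simp only [← Finset.sum_add_distrib, ← hsplit]
  rw [Finset.sum_comm (f := fun i j => if j < i then f j i else 0)] at hsum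
  linarith

/-- Twice the bilinear Dirichlet form of symmetric weights, written through the graph Laplacian. -/
theorem sum_sum_mul_sub_mul_sub {ι : Type*} [Fintype ι] (w : ι → ι → ℝ)
    (hw : ∀ i j, w i j = w j i) (s t : ι → ℝ) :
    ∑ i, ∑ j, w i j * ((s i - s j) * (t i - t j)) = 2 * ∑ i, t i * ∑ j, w i j * (s i - s j) := by
  have hleft : ∑ i, t i * ∑ j, w i j * (s i - s j) = ∑ i, ∑ j, t i * (w i j * (s i - s j)) := by
    simp only [Finset.mul_sum]
  have hswap : ∑ i, ∑ j, t i * (w i j * (s i - s j)) = ∑ i, ∑ j, t j * (w i j * (s j - s i)) := by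
    rw [Finset.sum_comm]
    refine Finset.sum_congr rfl fun i _ => Finset.sum_congr rfl fun j _ => ?_
    rw [hw]
  rw [hleft, two_mul]
  nth_rewrite 2 [hswap]
  simp only [← Finset.sum_add_distrib]
  refine Finset.sum_congr rfl fun i _ => Finset.sum_congr rfl fun j _ => ?_
  ring

/-- Expansion of a regularized Dirichlet energy around a stationary point `s`. -/
theorem dirichlet_energy_expansion {ι : Type*} [Fintype ι] (w : ι → ι → ℝ)
    (hw : ∀ i j, w i j = w j i) (b l s x : ι → ℝ)
    (hs : ∀ i, ∑ j, w i j * (s i - s j) + b i * (s i - l i) = 0) :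
    (1 / 2) * ∑ i, ∑ j, w i j * (x i - x j) ^ 2 + ∑ i, b i * (x i - l i) ^ 2 =
      ((1 / 2) * ∑ i, ∑ j, w i j * (s i - s j) ^ 2 + ∑ i, b i * (s i - l i) ^ 2) +
      ((1 / 2) * ∑ i, ∑ j, w i j * ((x i - s i) - (x j - s j)) ^ 2
        + ∑ i, b i * (x i - s i) ^ 2) := by
  have hcross := sum_sum_mul_sub_mul_sub w hw s (fun i => x i - s i)
  have hstat : ∑ i, (x i - s i) * ∑ j, w i j * (s i - s j)
      + ∑ i, (x i - s i) * (b i * (s i - l i)) = 0 := by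
    rw [← Finset.sum_add_distrib]
    refine Finset.sum_eq_zero fun i _ => ?_
    rw [← mul_add, hs, mul_zero]
  have hpair : ∑ i, ∑ j, w i j * (x i - x j) ^ 2 = ∑ i, ∑ j, w i j * (s i - s j) ^ 2
      + 2 * ∑ i, ∑ j, w i j * ((s i - s j) * ((x i - s i) - (x j - s j)))
      + ∑ i, ∑ j, w i j * ((x i - s i) - (x j - s j)) ^ 2 := by
    simp only [Finset.mul_sum, ← Finset.sum_add_distrib]
    refine Finset.sum_congr rfl fun i _ => Finset.sum_congr rfl fun j _ => ?_
    ring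
  have hpoint : ∑ i, b i * (x i - l i) ^ 2 = ∑ i, b i * (s i - l i) ^ 2
      + 2 * ∑ i, (x i - s i) * (b i * (s i - l i)) + ∑ i, b i * (x i - s i) ^ 2 := by
    simp only [Finset.mul_sum, ← Finset.sum_add_distrib]
    refine Finset.sum_congr rfl fun i _ => ?_
    ring
  linarith

/-- The matrix `I − ᾱ(I − C) − αP` is invertible, and the unique global
minimizer of `Q_mp` over `ℝ^{n×p}` is `Θ* = ᾱ (I − ᾱ(I − C) − αP)⁻¹ C Θ^loc`. -/
theorem model_propagation_closed_form
    (n p : ℕ) (hn : 2 ≤ n) (hp : 1 ≤ p)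
    (W : Matrix (Fin n) (Fin n) ℝ)
    (hWsymm : ∀ i j, W i j = W j i)
    (hWnn : ∀ i j, 0 ≤ W i j)
    (hWdiag : ∀ i, W i i = 0)
    (hconn : (SimpleGraph.fromRel (fun i j => 0 < W i j)).Connected)
    (D : Matrix (Fin n) (Fin n) ℝ)
    (hD : D = Matrix.diagonal (fun i => ∑ j, W i j))
    (P : Matrix (Fin n) (Fin n) ℝ) (hP : P = D⁻¹ * W)
    (c : Fin n → ℝ) (hc : ∀ i, 0 < c i ∧ c i ≤ 1)
    (C : Matrix (Fin n) (Fin n) ℝ) (hC : C = Matrix.diagonal c)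
    (α : ℝ) (hα : 0 < α ∧ α < 1)
    (Θloc : Matrix (Fin n) (Fin p) ℝ)
    (Q : Matrix (Fin n) (Fin p) ℝ → ℝ)
    (hQ : ∀ Θ, Q Θ = (1/2) *
      ((∑ i, ∑ j, if i < j then W i j * (∑ k, (Θ i k - Θ j k)^2) else 0)
        + ((1-α)/α) * ∑ i, D i i * c i * (∑ k, (Θ i k - Θloc i k)^2))) :
    IsUnit (1 - (1-α) • ((1 : Matrix (Fin n) (Fin n) ℝ) - C) - α • P) ∧
    ∀ Θ, Θ ≠ (1-α) • ((1 - (1-α) • ((1 : Matrix (Fin n) (Fin n) ℝ) - C) - α • P)⁻¹ * C * Θloc) →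
      Q ((1-α) • ((1 - (1-α) • ((1 : Matrix (Fin n) (Fin n) ℝ) - C) - α • P)⁻¹ * C * Θloc)) < Q Θ := by
  obtain ⟨hα0, hα1⟩ := hα
  have : Nontrivial (Fin n) := Fin.nontrivial_iff_two_le.mpr hn
  have hd : ∀ i, 0 < ∑ j, W i j := by
    intro i
    obtain ⟨j, hj⟩ := hconn.preconnected.exists_adj_of_nontrivial i
    rw [SimpleGraph.fromRel_adj] at hj
    have hij : 0 < W i j := hj.2.elim id fun h => hWsymm i j ▸ h
    exact Finset.sum_pos' (fun j _ => hWnn i j) ⟨j, Finset.mem_univ j, hij⟩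
  have hDinv : D⁻¹ = Matrix.diagonal fun i => (∑ j, W i j)⁻¹ := by
    rw [hD]
    refine Matrix.inv_eq_right_inv ?_
    rw [Matrix.diagonal_mul_diagonal, ← Matrix.diagonal_one]
    congr 1
    funext i
    exact mul_inv_cancel₀ (hd i).ne'
  have hPij : ∀ i j, P i j = (∑ j, W i j)⁻¹ * W i j := by
    intro i j
    rw [hP, hDinv, Matrix.diagonal_mul]
  have hPnn : ∀ i j, 0 ≤ P i j := fun i j => by
    rw [hPij]
    exact mul_nonneg (inv_nonneg.mpr (hd i).le) (hWnn i j)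
  have hProw : ∀ i, ∑ j, P i j = 1 := fun i => by
    simp only [hPij, ← Finset.mul_sum]
    exact inv_mul_cancel₀ (hd i).ne'
  set M : Matrix (Fin n) (Fin n) ℝ := 1 - (1-α) • ((1 : Matrix (Fin n) (Fin n) ℝ) - C) - α • P
    with hM
  have hM' : M = Matrix.diagonal (fun i => α + (1 - α) * c i) - α • P := by
    rw [hM, hC]
    ext i j
    by_cases h : i = j
    · subst h
      simp
      ring
    · simp [h]
  have hdet : M.det ≠ 0 := by
    refine det_ne_zero_of_sum_row_lt_diag fun i => ?_
    have hoff : ∑ j ∈ Finset.univ.erase i, ‖M i j‖ = α := by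
      have hnorm : ∀ j ∈ Finset.univ.erase i, ‖M i j‖ = α * P i j := by
        intro j hj
        rw [hM', Matrix.sub_apply, Matrix.diagonal_apply_ne' _ (Finset.ne_of_mem_erase hj),
          Matrix.smul_apply, smul_eq_mul, zero_sub, norm_neg, Real.norm_of_nonneg]
        exact mul_nonneg hα0.le (hPnn i j)
      rw [Finset.sum_congr rfl hnorm, ← Finset.mul_sum, Finset.sum_erase _ (by simp [hPij, hWdiag]),
        hProw, mul_one]
    have hdiag : M i i = α + (1 - α) * c i := by
      simp [hM', hPij, hWdiag]
    have hpos : 0 < (1 - α) * c i := mul_pos (sub_pos.mpr hα1) (hc i).1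
    rw [hoff, hdiag, Real.norm_of_nonneg (by linarith)]
    linarith
  have hunit : IsUnit M.det := hdet.isUnit
  refine ⟨(Matrix.isUnit_iff_isUnit_det M).mpr hunit, fun Θ hne => ?_⟩
  set S := (1-α) • (M⁻¹ * C * Θloc) with hS
  have hMS : M * S = (1 - α) • (C * Θloc) := by
    rw [hS, Matrix.mul_smul, Matrix.mul_assoc, Matrix.mul_nonsing_inv_cancel_left _ _ hunit]
  set b : Fin n → ℝ := fun i => ((1 - α) / α) * ((∑ j, W i j) * c i) with hb
  have hbpos : ∀ i, 0 < b i := fun i =>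
    mul_pos (div_pos (sub_pos.mpr hα1) hα0) (mul_pos (hd i) (hc i).1)
  have hstat : ∀ k i, ∑ j, W i j * (S i k - S j k) + b i * (S i k - Θloc i k) = 0 := by
    intro k i
    have h := congrFun (congrFun hMS i) k
    rw [hM', Matrix.sub_mul, Matrix.sub_apply, Matrix.diagonal_mul, Matrix.smul_mul,
      Matrix.smul_apply, Matrix.smul_apply, hC, Matrix.diagonal_mul, Matrix.mul_apply] at h
    simp only [hPij, mul_assoc, ← Finset.mul_sum, smul_eq_mul] at h
    simp only [mul_sub, Finset.sum_sub_distrib, ← Finset.sum_mul, hb]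
    have hdi := (hd i).ne'
    have hα := hα0.ne'
    field_simp at h ⊢
    linear_combination h
  have hQcol : ∀ X, Q X = (1 / 2) * ∑ k, ((1 / 2) * ∑ i, ∑ j, W i j * (X i k - X j k) ^ 2
      + ∑ i, b i * (X i k - Θloc i k) ^ 2) := by
    intro X
    rw [hQ, sum_lt_eq_half_sum (fun i j => W i j * ∑ k, (X i k - X j k) ^ 2), hD]
    · rw [Finset.sum_add_distrib, ← Finset.mul_sum]
      congr 2
      · congr 1
        simp only [Finset.mul_sum]
        exact Finset.sum_comm_cycle
      · rw [Finset.sum_comm]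
        simp only [Finset.mul_sum, hb, Matrix.diagonal_apply_eq, mul_assoc]
    · intro i j
      rw [hWsymm i j]
      simp only [sub_sq_comm]
    · simp [hWdiag]
  rw [hQcol, hQcol]
  refine mul_lt_mul_of_pos_left ?_ (by norm_num)
  have hexp := fun k => dirichlet_energy_expansion W hWsymm b (fun i => Θloc i k)
    (fun i => S i k) (fun i => Θ i k) (hstat k)
  have hgap : ∀ k, 0 ≤ (1 / 2) * ∑ i, ∑ j, W i j * ((Θ i k - S i k) - (Θ j k - S j k)) ^ 2 :=
    fun k => mul_nonneg (by norm_num) <| Finset.sum_nonneg fun i _ => Finset.sum_nonneg fun j _ =>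
      mul_nonneg (hWnn i j) (sq_nonneg _)
  have hterm : ∀ k i, 0 ≤ b i * (Θ i k - S i k) ^ 2 := fun k i =>
    mul_nonneg (hbpos i).le (sq_nonneg _)
  obtain ⟨i, k, hik⟩ : ∃ i k, Θ i k ≠ S i k := by
    by_contra! h
    exact hne (Matrix.ext h)
  refine Finset.sum_lt_sum (fun k _ => ?_) ⟨k, Finset.mem_univ k, ?_⟩
  · linarith [hexp k, hgap k, Finset.sum_nonneg fun i (_ : i ∈ Finset.univ) => hterm k i]
  · have hpos : 0 < ∑ i, b i * (Θ i k - S i k) ^ 2 :=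
      Finset.sum_pos' (fun i _ => hterm k i) ⟨i, Finset.mem_univ i,
        mul_pos (hbpos i) (sq_pos_of_ne_zero (sub_ne_zero.mpr hik))⟩
    linarith [hexp k, hgap k]
end

section
/- The spectral radius of the matrix M = (αI + ᾱC)⁻¹ αP is strictly less than 1. -/
open Matrix Finset

/-- A complex matrix all of whose rows have `ℓ¹` norm less than `1` has its spectrum in the open
unit disc. -/
theorem norm_lt_one_of_mem_spectrum_of_sum_norm_lt_one {ι : Type*} [Fintype ι] [DecidableEq ι]
    {A : Matrix ι ι ℂ} (hA : ∀ i, ∑ j, ‖A i j‖ < 1) {μ : ℂ} (hμ : μ ∈ spectrum ℂ A) :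
    ‖μ‖ < 1 := by
  rw [← Matrix.spectrum_toLin', ← Module.End.hasEigenvalue_iff_mem_spectrum] at hμ
  obtain ⟨k, hk⟩ := eigenvalue_mem_ball hμ
  rw [mem_closedBall_iff_norm] at hk
  calc
    ‖μ‖ ≤ ‖A k k‖ + ‖μ - A k k‖ := norm_le_norm_add_norm_sub' μ (A k k)
    _ ≤ ‖A k k‖ + ∑ j ∈ univ.erase k, ‖A k j‖ := by gcongr
    _ = ∑ j, ‖A k j‖ := add_sum_erase _ (fun j => ‖A k j‖) (mem_univ k)
    _ < 1 := hA k

/-- Normalizing the rows of a nonnegative matrix gives a row-substochastic matrix. -/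
theorem sum_abs_inv_diagonal_rowSum_mul_le_one {ι : Type*} [Fintype ι] [DecidableEq ι]
    {W : Matrix ι ι ℝ} (hW : ∀ i j, 0 ≤ W i j) (i : ι) :
    ∑ j, |((diagonal fun k => ∑ l, W k l)⁻¹ * W) i j| ≤ 1 := by
  rw [inv_diagonal]
  by_cases h : IsUnit fun k => ∑ l, W k l
  · have hd : (∑ l, W i l) ≠ 0 := (Pi.isUnit_iff.mp h i).ne_zero
    have hinv : Ring.inverse (fun k => ∑ l, W k l) i = (∑ l, W i l)⁻¹ := by
      have := congrFun (Ring.inverse_mul_cancel _ h) i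
      exact eq_inv_of_mul_eq_one_left this
    have hnn : 0 ≤ (∑ l, W i l)⁻¹ := inv_nonneg.mpr (sum_nonneg fun l _ => hW i l)
    simp_rw [diagonal_mul, hinv, abs_mul, abs_of_nonneg hnn, abs_of_nonneg (hW i _)]
    rw [← mul_sum, inv_mul_cancel₀ hd]
  · simp [Ring.inverse_non_unit _ h]

/-- The spectral radius of `M = (αI + ᾱC)⁻¹ αP` is strictly less than 1
(every complex eigenvalue has modulus < 1). -/
theorem spectral_radius_M_lt_one
    (n : ℕ) (hn : 2 ≤ n)
    (W : Matrix (Fin n) (Fin n) ℝ)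
    (hWsymm : ∀ i j, W i j = W j i)
    (hWnn : ∀ i j, 0 ≤ W i j)
    (hWdiag : ∀ i, W i i = 0)
    (hconn : (SimpleGraph.fromRel (fun i j => 0 < W i j)).Connected)
    (D : Matrix (Fin n) (Fin n) ℝ)
    (hD : D = Matrix.diagonal (fun i => ∑ j, W i j))
    (P : Matrix (Fin n) (Fin n) ℝ) (hP : P = D⁻¹ * W)
    (c : Fin n → ℝ) (hc : ∀ i, 0 < c i ∧ c i ≤ 1)
    (C : Matrix (Fin n) (Fin n) ℝ) (hC : C = Matrix.diagonal c)
    (α : ℝ) (hα : 0 < α ∧ α < 1)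
    (M : Matrix (Fin n) (Fin n) ℝ)
    (hM : M = (α • (1 : Matrix (Fin n) (Fin n) ℝ) + (1-α) • C)⁻¹ * (α • P)) :
    ∀ μ ∈ spectrum ℂ (M.map Complex.ofReal), ‖μ‖ < 1 := by
  subst hM hC hP hD
  obtain ⟨hα₀, hα₁⟩ := hα
  have hpos (i) : 0 < (1 - α) * c i := mul_pos (sub_pos.mpr hα₁) (hc i).1
  have hinv : (α • (1 : Matrix (Fin n) (Fin n) ℝ) + (1 - α) • diagonal c)⁻¹ =
      diagonal fun i => (α + (1 - α) * c i)⁻¹ := by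
    refine inv_eq_left_inv ?_
    rw [smul_one_eq_diagonal, ← diagonal_smul, diagonal_add, diagonal_mul_diagonal,
      ← diagonal_one]
    congr 1
    ext i
    exact inv_mul_cancel₀ (add_pos hα₀ (hpos i)).ne'
  refine fun μ => norm_lt_one_of_mem_spectrum_of_sum_norm_lt_one fun i => ?_
  have hden : 0 < α + (1 - α) * c i := add_pos hα₀ (hpos i)
  simp only [hinv, map_apply, Complex.norm_real, Real.norm_eq_abs, diagonal_mul,
    Matrix.smul_apply, smul_eq_mul, abs_mul, abs_of_pos hα₀, abs_of_pos (inv_pos.mpr hden),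
    ← mul_sum]
  calc
    _ ≤ (α + (1 - α) * c i)⁻¹ * (α * 1) := by
      gcongr
      exact sum_abs_inv_diagonal_rowSum_mul_le_one hWnn i
    _ < 1 := by
      rw [mul_one, inv_mul_lt_one₀ hden]
      exact lt_add_of_pos_right α (hpos i)
end

section
/- Every (complex) eigenvalue of the matrix M = (αI + ᾱC)⁻¹ αP is real and lies in the open interval (−1, 1); equivalently, every eigenvalue of I − M is real and lies in (0, 2). In particular, M is diagonally similar to a symmetric matrix: with the positive diagonal matrix S = ((αI + ᾱC)D)^{1/2}, one has S M S⁻¹ = α S⁻¹ W S⁻¹, which is symmetric. -/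
open Matrix Finset

lemma inv_diagonal_of_pos {ι : Type*} [Fintype ι] [DecidableEq ι] {d : ι → ℝ}
    (hd : ∀ i, 0 < d i) : (diagonal d)⁻¹ = diagonal fun i => (d i)⁻¹ := by
  apply Matrix.inv_eq_right_inv
  rw [diagonal_mul_diagonal, ← diagonal_one]
  congr 1
  funext i
  exact mul_inv_cancel₀ (hd i).ne'

/-- An eigenvalue of the pencil `A - μ diag(q)`, with `A` real symmetric and `diag(q)` strictly
dominating the absolute row sums of `A`, is real and lies in `(-1, 1)`. -/
lemma real_of_mulVec_eq_mul_diagonal {ι : Type*} [Fintype ι] (A : ι → ι → ℝ)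
    (q : ι → ℝ) (hA : ∀ i j, A i j = A j i) (hq : ∀ i, ∑ j, |A i j| < q i)
    (μ : ℂ) (v : ι → ℂ) (hv : v ≠ 0) (h : ∀ i, ∑ j, (A i j : ℂ) * v j = μ * (q i * v i)) :
    ∃ r : ℝ, μ = (r : ℂ) ∧ -1 < r ∧ r < 1 := by
  obtain ⟨k, hk⟩ := Function.ne_iff.mp hv
  have hqpos : ∀ i, 0 < q i := fun i =>
    (Finset.sum_nonneg fun j _ => abs_nonneg (A i j)).trans_lt (hq i)
  have hnorm : ‖μ‖ < 1 := by
    obtain ⟨i, -, hi⟩ := Finset.exists_max_image Finset.univ (fun i => ‖v i‖) ⟨k, mem_univ k⟩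
    have hvi : 0 < ‖v i‖ := (norm_pos_iff.mpr hk).trans_le (hi k (mem_univ k))
    have key : ‖μ‖ * (q i * ‖v i‖) < 1 * (q i * ‖v i‖) := calc
      ‖μ‖ * (q i * ‖v i‖) = ‖μ * (q i * v i)‖ := by simp [abs_of_pos (hqpos i)]
      _ = ‖∑ j, (A i j : ℂ) * v j‖ := by rw [h]
      _ ≤ ∑ j, |A i j| * ‖v i‖ := by
        refine norm_sum_le_of_le _ fun j hj => ?_
        rw [norm_mul, Complex.norm_real, Real.norm_eq_abs]
        exact mul_le_mul_of_nonneg_left (hi j hj) (abs_nonneg _)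
      _ = (∑ j, |A i j|) * ‖v i‖ := (Finset.sum_mul ..).symm
      _ < 1 * (q i * ‖v i‖) := by
        rw [one_mul]
        exact mul_lt_mul_of_pos_right (hq i) hvi
    exact lt_of_mul_lt_mul_right key (mul_pos (hqpos i) hvi).le
  have hreal : (starRingEnd ℂ) μ = μ := by
    set N : ℝ := ∑ i, q i * Complex.normSq (v i)
    have hN : 0 < N := Finset.sum_pos'
      (fun i _ => mul_nonneg (hqpos i).le (Complex.normSq_nonneg _))
      ⟨k, mem_univ k, mul_pos (hqpos k) (Complex.normSq_pos.mpr hk)⟩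
    set Q : ℂ := ∑ i, ∑ j, (starRingEnd ℂ) (v i) * (A i j * v j)
    have hQN : Q = μ * N := by
      simp only [Q, N, ← Finset.mul_sum, h, Complex.ofReal_sum, Complex.ofReal_mul,
        Complex.normSq_eq_conj_mul_self]
      rw [Finset.mul_sum]
      exact Finset.sum_congr rfl fun i _ => by ring
    have hQ : (starRingEnd ℂ) Q = Q := by
      simp only [Q, map_sum, map_mul, Complex.conj_conj, Complex.conj_ofReal]
      rw [Finset.sum_comm]
      refine Finset.sum_congr rfl fun i _ => Finset.sum_congr rfl fun j _ => ?_
      rw [hA j i]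
      ring
    rw [hQN, map_mul, Complex.conj_ofReal] at hQ
    exact mul_right_cancel₀ (Complex.ofReal_ne_zero.mpr hN.ne') hQ
  obtain ⟨r, rfl⟩ := Complex.conj_eq_iff_real.mp hreal
  rw [Complex.norm_real, Real.norm_eq_abs, abs_lt] at hnorm
  exact ⟨r, rfl, hnorm⟩

/-- Every complex eigenvalue of `M = (αI + ᾱC)⁻¹ αP` is real and lies in `(−1, 1)`;
equivalently every eigenvalue of `I − M` is real and lies in `(0, 2)`. Moreover, with the positive
diagonal matrix `S = ((αI + ᾱC)D)^{1/2}`, one has `S M S⁻¹ = α S⁻¹ W S⁻¹`, which is symmetric. -/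
theorem eigenvalues_M_real_in_unit_interval
    (n : ℕ) (hn : 2 ≤ n)
    (W : Matrix (Fin n) (Fin n) ℝ)
    (hWsymm : ∀ i j, W i j = W j i)
    (hWnn : ∀ i j, 0 ≤ W i j)
    (hWdiag : ∀ i, W i i = 0)
    (hconn : (SimpleGraph.fromRel (fun i j => 0 < W i j)).Connected)
    (D : Matrix (Fin n) (Fin n) ℝ)
    (hD : D = Matrix.diagonal (fun i => ∑ j, W i j))
    (P : Matrix (Fin n) (Fin n) ℝ) (hP : P = D⁻¹ * W)
    (c : Fin n → ℝ) (hc : ∀ i, 0 < c i ∧ c i ≤ 1)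
    (C : Matrix (Fin n) (Fin n) ℝ) (hC : C = Matrix.diagonal c)
    (α : ℝ) (hα : 0 < α ∧ α < 1)
    (M : Matrix (Fin n) (Fin n) ℝ)
    (hM : M = (α • (1 : Matrix (Fin n) (Fin n) ℝ) + (1-α) • C)⁻¹ * (α • P))
    (S : Matrix (Fin n) (Fin n) ℝ)
    (hS : S = Matrix.diagonal (fun i => Real.sqrt ((α + (1-α) * c i) * D i i))) :
    (∀ μ ∈ spectrum ℂ (M.map Complex.ofReal), ∃ r : ℝ, μ = (r : ℂ) ∧ -1 < r ∧ r < 1) ∧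
    (∀ μ ∈ spectrum ℂ ((1 - M).map Complex.ofReal), ∃ r : ℝ, μ = (r : ℂ) ∧ 0 < r ∧ r < 2) ∧
    S * M * S⁻¹ = α • (S⁻¹ * W * S⁻¹) ∧
    (α • (S⁻¹ * W * S⁻¹)).IsSymm := by
  obtain ⟨hα0, hα1⟩ := hα
  have : Nontrivial (Fin n) := Fin.nontrivial_iff_two_le.mpr hn
  have hd : ∀ i, 0 < ∑ j, W i j := fun i => by
    obtain ⟨j, hj⟩ := hconn.preconnected.exists_adj_of_nontrivial i
    have hij : 0 < W i j := by
      rcases (SimpleGraph.fromRel_adj _ _ _).mp hj with ⟨-, h | h⟩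
      · exact h
      · exact hWsymm i j ▸ h
    exact Finset.sum_pos' (fun j _ => hWnn i j) ⟨j, mem_univ j, hij⟩
  have he : ∀ i, α < α + (1 - α) * c i := fun i =>
    lt_add_of_pos_right α (mul_pos (sub_pos.mpr hα1) (hc i).1)
  have he0 : ∀ i, 0 < α + (1 - α) * c i := fun i => hα0.trans (he i)
  set q : Fin n → ℝ := fun i => (α + (1 - α) * c i) * ∑ j, W i j
  have hq : ∀ i, 0 < q i := fun i => mul_pos (he0 i) (hd i)
  have hMq : M = diagonal (fun i => (q i)⁻¹) * (α • W) := by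
    have hE : α • (1 : Matrix (Fin n) (Fin n) ℝ) + (1 - α) • C
        = diagonal fun i => α + (1 - α) * c i := by
      rw [hC, ← diagonal_one, ← diagonal_smul, ← diagonal_smul, diagonal_add]
      simp
    rw [hM, hP, hD, hE, inv_diagonal_of_pos he0, inv_diagonal_of_pos hd]
    ext i j
    simp only [diagonal_mul, Matrix.smul_apply, smul_eq_mul, q, mul_inv]
    ring
  have hSq : S = diagonal fun i => √(q i) := by
    rw [hS, hD]
    simp [q]
  have hSinv : S⁻¹ = diagonal fun i => (√(q i))⁻¹ := by
    rw [hSq, inv_diagonal_of_pos fun i => Real.sqrt_pos.mpr (hq i)]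
  have hspec : ∀ μ ∈ spectrum ℂ (M.map Complex.ofReal),
      ∃ r : ℝ, μ = (r : ℂ) ∧ -1 < r ∧ r < 1 := fun μ hμ => by
    rw [← spectrum_toLin', ← Module.End.hasEigenvalue_iff_mem_spectrum] at hμ
    obtain ⟨v, hv⟩ := hμ.exists_hasEigenvector
    refine real_of_mulVec_eq_mul_diagonal (fun i j => α * W i j) q
      (fun i j => by rw [hWsymm]) (fun i => ?_) μ v hv.2 fun i => ?_
    · simp only [abs_of_nonneg (mul_nonneg hα0.le (hWnn i _)), ← Finset.mul_sum]
      exact mul_lt_mul_of_pos_right (he i) (hd i)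
    · have hi := congrFun hv.apply_eq_smul i
      simp only [toLin'_apply, mulVec, dotProduct, map_apply, hMq, diagonal_mul, Matrix.smul_apply,
        smul_eq_mul, Pi.smul_apply] at hi
      have hqi : (q i : ℂ) ≠ 0 := Complex.ofReal_ne_zero.mpr (hq i).ne'
      rw [mul_left_comm, ← hi, Finset.mul_sum]
      refine Finset.sum_congr rfl fun j _ => ?_
      push_cast
      field_simp
  refine ⟨hspec, fun μ hμ => ?_, ?_, ?_⟩
  · have hsub : (1 - M).map Complex.ofReal
        = algebraMap ℂ (Matrix (Fin n) (Fin n) ℂ) 1 - M.map Complex.ofReal := by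
      rw [map_one, Matrix.map_sub _ Complex.ofReal_sub, Matrix.map_one _ Complex.ofReal_zero
        Complex.ofReal_one]
    rw [hsub, ← spectrum.singleton_sub_eq, Set.singleton_sub] at hμ
    obtain ⟨ν, hν, rfl⟩ := hμ
    obtain ⟨r, rfl, hr⟩ := hspec ν hν
    exact ⟨1 - r, by push_cast; rfl, by linarith, by linarith⟩
  · rw [hSinv, hSq, hMq]
    ext i j
    have hs := Real.sqrt_pos.mpr (hq i)
    simp only [mul_diagonal, diagonal_mul, Matrix.smul_apply, smul_eq_mul]
    nth_rewrite 2 [← Real.mul_self_sqrt (hq i).le]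
    field_simp
  · rw [hSinv]
    ext i j
    simp only [transpose_apply, mul_diagonal, diagonal_mul, Matrix.smul_apply, smul_eq_mul, hWsymm j i]
    ring
end

section
/- For any i ≠ j with (i,j) ∈ E, every (complex) eigenvalue of the matrix U(i,j) is real and lies in the interval [−1, 1]. -/
open Matrix Finset

/-- The standard basis vector of `ℝ^{n²}` (indexed by pairs, the pair `(i,j)` encoding
coordinate `(i−1)n + j`) with a 1 in coordinate `(i,j)`. -/
def eVec (n : ℕ) (i j : Fin n) : Fin n × Fin n → ℝ :=
  fun q => if q = (i, j) then 1 else 0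

/-- The communication matrix `O(i,j) = I + e_i^j(e_j^j − e_i^j)ᵀ + e_j^i(e_i^i − e_j^i)ᵀ`. -/
def Omat (n : ℕ) (i j : Fin n) : Matrix (Fin n × Fin n) (Fin n × Fin n) ℝ :=
  1 + Matrix.vecMulVec (eVec n i j) (eVec n j j - eVec n i j)
    + Matrix.vecMulVec (eVec n j i) (eVec n i i - eVec n j i)

/-- The `n² × n²` block-diagonal matrix with `n` diagonal blocks equal to `M`. -/
def blockDiag (n : ℕ) (M : Matrix (Fin n) (Fin n) ℝ) :
    Matrix (Fin n × Fin n) (Fin n × Fin n) ℝ :=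
  Matrix.of fun q r => if q.1 = r.1 then M q.2 r.2 else 0

/-- The update matrix `U(i,j) = I + (e_i^i(e_i^i)ᵀ + e_j^j(e_j^j)ᵀ)(M_blk − I)`. -/
def Umat (n : ℕ) (M : Matrix (Fin n) (Fin n) ℝ) (i j : Fin n) :
    Matrix (Fin n × Fin n) (Fin n × Fin n) ℝ :=
  1 + (Matrix.vecMulVec (eVec n i i) (eVec n i i)
      + Matrix.vecMulVec (eVec n j j) (eVec n j j)) * (blockDiag n M - 1)

theorem eVec_eq_single (n : ℕ) (i j : Fin n) : eVec n i j = Pi.single (i, j) 1 := by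
  ext q
  simp [eVec, Pi.single_apply]

/-- The matrix `1 + e * (b - 1)` is idempotent once `e` is and `e * b * e = 0`. -/
theorem isIdempotentElem_one_add_mul_sub_one {R : Type*} [Ring R] {e b : R}
    (he : IsIdempotentElem e) (heb : e * b * e = 0) :
    IsIdempotentElem (1 + e * (b - 1)) := by
  have h : e * (b - 1) * (e * (b - 1)) = -(e * (b - 1)) := by
    calc e * (b - 1) * (e * (b - 1)) = (e * b * e - e * e) * (b - 1) := by noncomm_ring
      _ = -(e * (b - 1)) := by rw [heb, he.eq, zero_sub, neg_mul]
  unfold IsIdempotentElem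
  rw [add_mul, mul_add, mul_add, h]
  simp

/-- If the diagonal of `M` vanishes, then `U(i,j)` is idempotent. -/
theorem isIdempotentElem_Umat {n : ℕ} {M : Matrix (Fin n) (Fin n) ℝ} (hM : ∀ k, M k k = 0)
    {i j : Fin n} (hij : i ≠ j) : IsIdempotentElem (Umat n M i j) := by
  have hE : ∀ k l : Fin n × Fin n, k ≠ l → (Matrix.single k k (1 : ℝ)) * Matrix.single l l 1 = 0 :=
    fun k l hkl => Matrix.single_mul_single_of_ne _ _ _ _ hkl _
  have hij' : (i, i) ≠ (j, j) := by simpa using hij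
  apply isIdempotentElem_one_add_mul_sub_one
  · simp [IsIdempotentElem, eVec_eq_single, ← Matrix.single_eq_single_vecMulVec_single,
      mul_add, add_mul, hE _ _ hij', hE _ _ hij'.symm]
  · simp [eVec_eq_single, ← Matrix.single_eq_single_vecMulVec_single, mul_add, add_mul,
      Matrix.single_mul_mul_single, _root_.blockDiag, hM, hij, hij.symm]

/-- For any `i ≠ j` with `(i,j) ∈ E`, every complex eigenvalue of `U(i,j)`
is real and lies in `[−1, 1]`. -/
theorem eigenvalues_Umat_real_in_closed_unit_interval
    (n : ℕ) (hn : 2 ≤ n)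
    (W : Matrix (Fin n) (Fin n) ℝ)
    (hWsymm : ∀ i j, W i j = W j i)
    (hWnn : ∀ i j, 0 ≤ W i j)
    (hWdiag : ∀ i, W i i = 0)
    (hconn : (SimpleGraph.fromRel (fun i j => 0 < W i j)).Connected)
    (D : Matrix (Fin n) (Fin n) ℝ)
    (hD : D = Matrix.diagonal (fun i => ∑ j, W i j))
    (P : Matrix (Fin n) (Fin n) ℝ) (hP : P = D⁻¹ * W)
    (c : Fin n → ℝ) (hc : ∀ i, 0 < c i ∧ c i ≤ 1)
    (C : Matrix (Fin n) (Fin n) ℝ) (hC : C = Matrix.diagonal c)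
    (α : ℝ) (hα : 0 < α ∧ α < 1)
    (M : Matrix (Fin n) (Fin n) ℝ)
    (hM : M = (α • (1 : Matrix (Fin n) (Fin n) ℝ) + (1-α) • C)⁻¹ * (α • P))
    (i j : Fin n) (hij : i ≠ j) (hedge : 0 < W i j) :
    ∀ μ ∈ spectrum ℂ ((Umat n M i j).map Complex.ofReal),
      ∃ r : ℝ, μ = (r : ℂ) ∧ -1 ≤ r ∧ r ≤ 1 := by
  have hMdiag : ∀ k, M k k = 0 := by
    intro k
    have hS : α • (1 : Matrix (Fin n) (Fin n) ℝ) + (1 - α) • C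
        = Matrix.diagonal (fun l => α + (1 - α) * c l) := by
      rw [hC, ← Matrix.diagonal_one, ← Matrix.diagonal_smul, ← Matrix.diagonal_smul,
        Matrix.diagonal_add]
      simp
    rw [hM, hP, hD, hS, Matrix.inv_diagonal, Matrix.inv_diagonal]
    simp [Matrix.diagonal_mul, hWdiag]
  have hU : IsIdempotentElem ((Umat n M i j).map Complex.ofReal) :=
    (isIdempotentElem_Umat hMdiag hij).map Complex.ofRealHom.mapMatrix
  intro μ hμ
  rcases hU.spectrum_subset ℂ hμ with rfl | rfl
  · exact ⟨0, by simp⟩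
  · exact ⟨1, by simp⟩
end

section
/- For any i ≠ j with (i,j) ∈ E, every (complex) eigenvalue of the product matrix U(i,j) O(i,j) is real and lies in the interval [−1, 1]. -/
open Matrix Finset

theorem Ring.inverse_apply_nonneg {ι : Type*} {v : ι → ℝ} (hv : ∀ k, 0 ≤ v k) (k : ι) :
    0 ≤ Ring.inverse v k := by
  by_cases h : IsUnit v
  · have hk : v k * Ring.inverse v k = 1 := congrFun (Ring.mul_inverse_cancel v h) k
    rw [eq_inv_of_mul_eq_one_right hk]
    exact inv_nonneg.2 (hv k)
  · simp [Ring.inverse_non_unit v h]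

theorem Ring.inverse_apply_mul_le_one {ι : Type*} {v : ι → ℝ} {k : ι} {a : ℝ}
    (ha : a ≤ v k) (hv : 0 ≤ v k) : Ring.inverse v k * a ≤ 1 := by
  by_cases h : IsUnit v
  · have hk : v k * Ring.inverse v k = 1 := congrFun (Ring.mul_inverse_cancel v h) k
    rw [eq_inv_of_mul_eq_one_right hk, inv_mul_eq_div]
    exact div_le_one_of_le₀ ha hv
  · simp [Ring.inverse_non_unit v h]

/-- A row of a real matrix that is a standard basis vector selects a coordinate. -/
theorem map_ofReal_mulVec_of_row_eq {ι : Type*} [Fintype ι] [DecidableEq ι]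
    {A : Matrix ι ι ℝ} {q r : ι} (h : ∀ s, A q s = if s = r then 1 else 0) (v : ι → ℂ) :
    (A.map Complex.ofReal *ᵥ v) q = v r := by
  simp [mulVec, dotProduct, h, apply_ite Complex.ofReal]

theorem map_ofReal_mul_mulVec {ι : Type*} [Fintype ι] (A B : Matrix ι ι ℝ) (v : ι → ℂ) :
    (A * B).map Complex.ofReal *ᵥ v
      = A.map Complex.ofReal *ᵥ (B.map Complex.ofReal *ᵥ v) := by
  rw [mulVec_mulVec]
  exact congrArg (· *ᵥ v) (Matrix.map_mul (f := Complex.ofRealHom))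

theorem Omat_comm (n : ℕ) (i j : Fin n) : Omat n i j = Omat n j i := by
  simp only [Omat]
  abel

theorem Omat_apply_of_ne {n : ℕ} {i j : Fin n} {q : Fin n × Fin n}
    (h₁ : q ≠ (i, j)) (h₂ : q ≠ (j, i)) (s : Fin n × Fin n) :
    Omat n i j q s = if s = q then 1 else 0 := by
  simp [Omat, vecMulVec_apply, eVec, h₁, h₂, one_apply, eq_comm]

theorem Omat_apply_received {n : ℕ} {i j : Fin n} (hij : i ≠ j) (s : Fin n × Fin n) :
    Omat n i j (i, j) s = if s = (j, j) then 1 else 0 := by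
  simp [Omat, vecMulVec_apply, eVec, hij, one_apply, eq_comm]

theorem Umat_comm (n : ℕ) (M : Matrix (Fin n) (Fin n) ℝ) (i j : Fin n) :
    Umat n M i j = Umat n M j i := by
  rw [Umat, Umat, add_comm (vecMulVec (eVec n i i) _)]

theorem Umat_apply_of_ne {n : ℕ} (M : Matrix (Fin n) (Fin n) ℝ) {i j : Fin n} {q : Fin n × Fin n}
    (h₁ : q ≠ (i, i)) (h₂ : q ≠ (j, j)) (s : Fin n × Fin n) :
    Umat n M i j q s = if s = q then 1 else 0 := by
  simp [Umat, mul_apply, vecMulVec_apply, eVec, h₁, h₂, one_apply, eq_comm]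

theorem Umat_apply_updated {n : ℕ} (M : Matrix (Fin n) (Fin n) ℝ) {i j : Fin n} (hij : i ≠ j)
    (s : Fin n × Fin n) :
    Umat n M i j (i, i) s = if i = s.1 then M i s.2 else 0 := by
  simp [Umat, mul_apply, vecMulVec_apply, eVec, hij, one_apply, _root_.blockDiag]

section Eigenvector

variable {n : ℕ} {M : Matrix (Fin n) (Fin n) ℝ} {i j : Fin n} {μ : ℂ} {v : Fin n × Fin n → ℂ}

theorem eigenvector_apply_eq_zero
    (hv : (Umat n M i j * Omat n i j).map Complex.ofReal *ᵥ v = μ • v) (hμ : μ ≠ 1)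
    {q : Fin n × Fin n} (h₁ : q ≠ (i, i)) (h₂ : q ≠ (j, j)) (h₃ : q ≠ (i, j)) (h₄ : q ≠ (j, i)) :
    v q = 0 := by
  have h := congrFun hv q
  rw [map_ofReal_mul_mulVec] at h
  rw [map_ofReal_mulVec_of_row_eq (Umat_apply_of_ne M h₁ h₂),
    map_ofReal_mulVec_of_row_eq (Omat_apply_of_ne h₃ h₄)] at h
  have : (μ - 1) * v q = 0 := by
    rw [Pi.smul_apply, smul_eq_mul] at h
    linear_combination -h
  exact (mul_eq_zero.1 this).resolve_left (sub_ne_zero.2 hμ)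

theorem eigenvector_apply_received (hij : i ≠ j)
    (hv : (Umat n M i j * Omat n i j).map Complex.ofReal *ᵥ v = μ • v) :
    μ * v (i, j) = v (j, j) := by
  have h := congrFun hv (i, j)
  rw [map_ofReal_mul_mulVec] at h
  rw [map_ofReal_mulVec_of_row_eq (Umat_apply_of_ne M (by simp [hij.symm]) (by simp [hij])),
    map_ofReal_mulVec_of_row_eq (Omat_apply_received hij)] at h
  exact h.symm

theorem eigenvector_apply_updated (hij : i ≠ j) (hM : M i i = 0)
    (hv : (Umat n M i j * Omat n i j).map Complex.ofReal *ᵥ v = μ • v) (hμ : μ ≠ 1) :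
    μ * v (i, i) = M i j * v (j, j) := by
  have h := congrFun hv (i, i)
  rw [map_ofReal_mul_mulVec] at h
  rw [Pi.smul_apply, smul_eq_mul] at h
  rw [← h, mulVec, dotProduct, Finset.sum_eq_single (i, j)]
  · simp only [map_apply, Umat_apply_updated M hij]
    rw [map_ofReal_mulVec_of_row_eq (Omat_apply_received hij)]
    simp
  · rintro ⟨a, b⟩ - hs
    simp only [map_apply, Umat_apply_updated M hij]
    by_cases ha : i = a
    · subst ha
      by_cases hb : b = i
      · simp [hb, hM]
      · have hbj : b ≠ j := fun h => hs (by rw [h])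
        rw [map_ofReal_mulVec_of_row_eq
          (Omat_apply_of_ne (q := (i, b)) (by simp [hbj]) (by simp [hij]))]
        simp [eigenvector_apply_eq_zero hv hμ (q := (i, b)) (by simp [hb]) (by simp [hij])
          (by simp [hbj]) (by simp [hij])]
    · simp [ha]
  · simp

/-- An eigenvalue of `U(i,j) O(i,j)` is `1`, `0`, or a square root of `M i j * M j i`. -/
theorem eigenvalue_eq_one_or_zero_or_sq_eq (hij : i ≠ j) (hMi : M i i = 0) (hMj : M j j = 0)
    (hv : (Umat n M i j * Omat n i j).map Complex.ofReal *ᵥ v = μ • v) (hv0 : v ≠ 0) :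
    μ = 1 ∨ μ = 0 ∨ μ ^ 2 = ((M i j * M j i : ℝ) : ℂ) := by
  by_contra! hcon
  obtain ⟨hμ1, hμ0, hμ2⟩ := hcon
  have hv' : (Umat n M j i * Omat n j i).map Complex.ofReal *ᵥ v = μ • v := by
    rwa [Umat_comm, Omat_comm]
  have hx := eigenvector_apply_updated hij hMi hv hμ1
  have hy := eigenvector_apply_updated hij.symm hMj hv' hμ1
  push_cast at hμ2
  have hx0 : v (i, i) = 0 := by
    refine (mul_eq_zero.1 ?_).resolve_left (sub_ne_zero.2 hμ2)
    linear_combination μ * hx + M i j * hy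
  have hy0 : v (j, j) = 0 := by
    refine (mul_eq_zero.1 ?_).resolve_left (sub_ne_zero.2 hμ2)
    linear_combination μ * hy + M j i * hx
  have hxy := eigenvector_apply_received hij hv
  have hyx := eigenvector_apply_received hij.symm hv'
  refine hv0 (funext fun q => ?_)
  by_cases h₁ : q = (i, i)
  · simp [h₁, hx0]
  by_cases h₂ : q = (j, j)
  · simp [h₂, hy0]
  by_cases h₃ : q = (i, j)
  · simpa [h₃, hy0, hμ0] using hxy
  by_cases h₄ : q = (j, i)
  · simpa [h₄, hx0, hμ0] using hyx
  exact eigenvector_apply_eq_zero hv hμ1 h₁ h₂ h₃ h₄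

end Eigenvector

theorem exists_real_of_sq_eq_ofReal {μ : ℂ} {a : ℝ} (ha : 0 ≤ a) (ha1 : a ≤ 1)
    (h : μ ^ 2 = (a : ℂ)) : ∃ r : ℝ, μ = (r : ℂ) ∧ -1 ≤ r ∧ r ≤ 1 := by
  have hs : √a ≤ 1 := Real.sqrt_le_one.2 ha1
  have hs0 := Real.sqrt_nonneg a
  rw [← Real.sq_sqrt ha, Complex.ofReal_pow, sq_eq_sq_iff_eq_or_eq_neg] at h
  rcases h with h | h
  · exact ⟨√a, h, by linarith, hs⟩
  · exact ⟨-√a, by rw [h, Complex.ofReal_neg], by linarith, by linarith⟩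

/-- For any `i ≠ j` with `(i,j) ∈ E`, every complex eigenvalue of the product
`U(i,j) O(i,j)` is real and lies in `[−1, 1]`. -/
theorem eigenvalues_UO_real_in_closed_unit_interval
    (n : ℕ) (hn : 2 ≤ n)
    (W : Matrix (Fin n) (Fin n) ℝ)
    (hWsymm : ∀ i j, W i j = W j i)
    (hWnn : ∀ i j, 0 ≤ W i j)
    (hWdiag : ∀ i, W i i = 0)
    (hconn : (SimpleGraph.fromRel (fun i j => 0 < W i j)).Connected)
    (D : Matrix (Fin n) (Fin n) ℝ)
    (hD : D = Matrix.diagonal (fun i => ∑ j, W i j))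
    (P : Matrix (Fin n) (Fin n) ℝ) (hP : P = D⁻¹ * W)
    (c : Fin n → ℝ) (hc : ∀ i, 0 < c i ∧ c i ≤ 1)
    (C : Matrix (Fin n) (Fin n) ℝ) (hC : C = Matrix.diagonal c)
    (α : ℝ) (hα : 0 < α ∧ α < 1)
    (M : Matrix (Fin n) (Fin n) ℝ)
    (hM : M = (α • (1 : Matrix (Fin n) (Fin n) ℝ) + (1-α) • C)⁻¹ * (α • P))
    (i j : Fin n) (hij : i ≠ j) (hedge : 0 < W i j) :
    ∀ μ ∈ spectrum ℂ ((Umat n M i j * Omat n i j).map Complex.ofReal),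
      ∃ r : ℝ, μ = (r : ℂ) ∧ -1 ≤ r ∧ r ≤ 1 := by
  intro μ hμ
  have hMapp (k l : Fin n) : M k l = Ring.inverse (fun k => α + (1 - α) * c k) k * α *
      (Ring.inverse (fun k => ∑ l, W k l) k * W k l) := by
    have hdiag : α • (1 : Matrix (Fin n) (Fin n) ℝ) + (1 - α) • C
        = diagonal fun k => α + (1 - α) * c k := by
      ext a b
      by_cases hab : a = b
      · simp [hC, hab]
      · simp [hC, hab]
    rw [hM, hP, hD, hdiag, inv_diagonal, inv_diagonal, diagonal_mul, Matrix.smul_apply, diagonal_mul,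
      smul_eq_mul, mul_assoc]
  have hcα (k : Fin n) : 0 ≤ (1 - α) * c k := mul_nonneg (by linarith [hα.2]) (hc k).1.le
  have hMdiag (k : Fin n) : M k k = 0 := by rw [hMapp, hWdiag, mul_zero, mul_zero]
  have hden (k : Fin n) : 0 ≤ α + (1 - α) * c k := add_nonneg hα.1.le (hcα k)
  have hdeg (k : Fin n) : 0 ≤ ∑ l, W k l := Finset.sum_nonneg fun l _ => hWnn k l
  have hfst (k : Fin n) := mul_nonneg (Ring.inverse_apply_nonneg hden k) hα.1.le
  have hsnd (k l : Fin n) := mul_nonneg (Ring.inverse_apply_nonneg hdeg k) (hWnn k l)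
  have hMnn (k l : Fin n) : 0 ≤ M k l := by
    rw [hMapp]
    exact mul_nonneg (hfst k) (hsnd k l)
  have hMle (k l : Fin n) : M k l ≤ 1 := by
    rw [hMapp]
    refine mul_le_one₀ ?_ (hsnd k l) ?_
    · exact Ring.inverse_apply_mul_le_one (le_add_of_nonneg_right (hcα k)) (hden k)
    · exact Ring.inverse_apply_mul_le_one
        (Finset.single_le_sum (fun b _ => hWnn k b) (Finset.mem_univ l)) (hdeg k)
  rw [← Matrix.spectrum_toLin', ← Module.End.hasEigenvalue_iff_mem_spectrum] at hμ
  obtain ⟨v, hv⟩ := hμ.exists_hasEigenvector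
  have hveq := hv.apply_eq_smul
  rw [toLin'_apply] at hveq
  rcases eigenvalue_eq_one_or_zero_or_sq_eq hij (hMdiag i) (hMdiag j) hveq hv.2 with h | h | h
  · exact ⟨1, by simp [h], by norm_num, le_rfl⟩
  · exact ⟨0, by simp [h], by norm_num, zero_le_one⟩
  · exact exists_real_of_sq_eq_ofReal (mul_nonneg (hMnn i j) (hMnn j i))
      (mul_le_one₀ (hMle i j) (hMnn j i) (hMle j i)) h
end

section
/- For any i ≠ j with (i,j) ∈ E, the value −1 is not an eigenvalue of U(i,j) O(i,j); equivalently, the matrix I + U(i,j) O(i,j) is invertible. -/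
open Matrix Finset

theorem eVec_dotProduct (n : ℕ) (i j : Fin n) (v : Fin n × Fin n → ℝ) :
    eVec n i j ⬝ᵥ v = v (i, j) := by
  simp [eVec, dotProduct]

theorem Omat_mulVec {n : ℕ} {i j : Fin n} (hij : i ≠ j) (v : Fin n × Fin n → ℝ)
    (q : Fin n × Fin n) :
    (Omat n i j *ᵥ v) q =
      if q = (i, j) then v (j, j) else if q = (j, i) then v (i, i) else v q := by
  have hne : ((i, j) : Fin n × Fin n) ≠ (j, i) := fun h => hij (congrArg Prod.fst h)
  simp only [Omat, add_mulVec, one_mulVec, vecMulVec_mulVec, sub_dotProduct, eVec_dotProduct,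
    Pi.add_apply, Pi.smul_apply, MulOpposite.smul_eq_mul_unop, MulOpposite.unop_op]
  by_cases h1 : q = (i, j)
  · subst h1
    simp [eVec, hij]
  · by_cases h2 : q = (j, i)
    · subst h2
      simp [eVec, hij.symm]
    · simp [eVec, h1, h2]

theorem blockDiag_mulVec (n : ℕ) (M : Matrix (Fin n) (Fin n) ℝ) (v : Fin n × Fin n → ℝ)
    (q : Fin n × Fin n) :
    (blockDiag n M *ᵥ v) q = ∑ k, M q.2 k * v (q.1, k) := by
  simp only [_root_.blockDiag, mulVec, dotProduct, of_apply, Fintype.sum_prod_type, ite_mul, zero_mul]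
  rw [Finset.sum_eq_single q.1]
  · simp
  · intro a _ ha
    simp [ha.symm]
  · simp

theorem Umat_mulVec {n : ℕ} (M : Matrix (Fin n) (Fin n) ℝ) {i j : Fin n} (hij : i ≠ j)
    (v : Fin n × Fin n → ℝ) (q : Fin n × Fin n) :
    (Umat n M i j *ᵥ v) q =
      if q = (i, i) ∨ q = (j, j) then ∑ k, M q.2 k * v (q.1, k) else v q := by
  simp only [Umat, add_mulVec, ← mulVec_mulVec, sub_mulVec, one_mulVec, vecMulVec_mulVec,
    eVec_dotProduct, Pi.add_apply, Pi.sub_apply, Pi.smul_apply, blockDiag_mulVec,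
    MulOpposite.smul_eq_mul_unop, MulOpposite.unop_op]
  by_cases h1 : q = (i, i)
  · subst h1
    simp [eVec, hij]
  · by_cases h2 : q = (j, j)
    · subst h2
      simp [eVec, hij.symm]
    · simp [eVec, h1, h2]

/-- `I + U(i,j) O(i,j)` is invertible as soon as `M` vanishes at `(i,i)` and `(j,j)` and
`M i j * M j i ≠ 1`. -/
theorem isUnit_one_add_Umat_mul_Omat {n : ℕ} (M : Matrix (Fin n) (Fin n) ℝ) {i j : Fin n}
    (hij : i ≠ j) (hi : M i i = 0) (hj : M j j = 0) (hM : M i j * M j i ≠ 1) :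
    IsUnit (1 + Umat n M i j * Omat n i j) := by
  rw [← mulVec_injective_iff_isUnit]
  refine (injective_iff_map_eq_zero (1 + Umat n M i j * Omat n i j).mulVecLin).2 fun v hv => ?_
  have hji := hij.symm
  have key (q : Fin n × Fin n) : v q + (Umat n M i j *ᵥ (Omat n i j *ᵥ v)) q = 0 := by
    simpa [add_mulVec] using congrFun hv q
  simp only [Umat_mulVec M hij, Omat_mulVec hij] at key
  have hother (q : Fin n × Fin n) (h1 : q ≠ (i, i)) (h2 : q ≠ (j, j)) (h3 : q ≠ (i, j))
      (h4 : q ≠ (j, i)) : v q = 0 := by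
    have := key q
    simp only [h1, h2, h3, h4, or_self, if_false] at this
    linarith
  have hvij : v (i, j) = -v (j, j) := by
    have := key (i, j)
    simp [hij, hji] at this
    linarith
  have hvji : v (j, i) = -v (i, i) := by
    have := key (j, i)
    simp [hij, hji] at this
    linarith
  have hvii : v (i, i) + M i j * v (j, j) = 0 := by
    have := key (i, i)
    rw [if_pos (Or.inl rfl), Finset.sum_eq_single j] at this
    · simpa using this
    · intro k _ hk
      by_cases hki : k = i
      · simp [hki, hi]
      · simp [hk, hij, hother (i, k) (by simp [hki]) (by simp [hij]) (by simp [hk])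
          (by simp [hij])]
    · simp
  have hvjj : v (j, j) + M j i * v (i, i) = 0 := by
    have := key (j, j)
    rw [if_pos (Or.inr rfl), Finset.sum_eq_single i] at this
    · simpa [hji] using this
    · intro k _ hk
      by_cases hkj : k = j
      · simp [hkj, hj]
      · simp [hk, hji, hother (j, k) (by simp [hji]) (by simp [hkj]) (by simp [hji])
          (by simp [hk])]
    · simp
  have hii : v (i, i) = 0 := by
    have : (1 - M i j * M j i) * v (i, i) = 0 := by linear_combination hvii - M i j * hvjj
    exact (mul_eq_zero.1 this).resolve_left (sub_ne_zero.2 hM.symm)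
  have hjj : v (j, j) = 0 := by simpa [hii] using hvjj
  ext q
  by_cases h1 : q = (i, i)
  · simp [h1, hii]
  by_cases h2 : q = (j, j)
  · simp [h2, hjj]
  by_cases h3 : q = (i, j)
  · simp [h3, hvij, hjj]
  by_cases h4 : q = (j, i)
  · simp [h4, hvji, hii]
  exact hother q h1 h2 h3 h4

theorem neg_one_notMem_spectrum_map_ofReal {m : Type*} [Fintype m] [DecidableEq m]
    {A : Matrix m m ℝ} (hA : IsUnit (1 + A)) :
    (-1 : ℂ) ∉ spectrum ℂ (A.map Complex.ofReal) := by
  rw [spectrum.notMem_iff, map_neg, map_one]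
  have h := (hA.map (Complex.ofRealHom.mapMatrix (m := m))).neg
  rw [map_add, map_one, neg_add] at h
  exact h

/-- The entries of `(α I + (1 - α) C)⁻¹ (α D⁻¹ W)` with `C = diagonal c`,
where `D` is the degree matrix of `W`. -/
theorem inv_mul_smul_inv_mul_apply {m : Type*} [Fintype m] [DecidableEq m] (W : Matrix m m ℝ)
    (c : m → ℝ) (α : ℝ) (hs : ∀ i, α + (1 - α) * c i ≠ 0) (hd : ∀ i, ∑ k, W i k ≠ 0) (i j : m) :
    ((α • (1 : Matrix m m ℝ) + (1 - α) • diagonal c)⁻¹ *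
        (α • ((diagonal fun i => ∑ k, W i k)⁻¹ * W))) i j =
      α / (α + (1 - α) * c i) * (W i j / ∑ k, W i k) := by
  have inv (d : m → ℝ) (hd : ∀ i, d i ≠ 0) : (diagonal d)⁻¹ = diagonal fun i => (d i)⁻¹ := by
    refine inv_eq_right_inv ?_
    simp [hd]
  have hsum : α • (1 : Matrix m m ℝ) + (1 - α) • diagonal c =
      diagonal fun i => α + (1 - α) * c i := by
    ext a b
    by_cases h : a = b <;> simp [h]
  rw [hsum, inv _ hs, inv _ hd, diagonal_mul, Matrix.smul_apply, diagonal_mul, smul_eq_mul]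
  ring

/-- For any `i ≠ j` with `(i,j) ∈ E`, `−1` is not an eigenvalue of
`U(i,j) O(i,j)`; equivalently, `I + U(i,j) O(i,j)` is invertible. -/
theorem neg_one_not_eigenvalue_UO
    (n : ℕ) (hn : 2 ≤ n)
    (W : Matrix (Fin n) (Fin n) ℝ)
    (hWsymm : ∀ i j, W i j = W j i)
    (hWnn : ∀ i j, 0 ≤ W i j)
    (hWdiag : ∀ i, W i i = 0)
    (hconn : (SimpleGraph.fromRel (fun i j => 0 < W i j)).Connected)
    (D : Matrix (Fin n) (Fin n) ℝ)
    (hD : D = Matrix.diagonal (fun i => ∑ j, W i j))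
    (P : Matrix (Fin n) (Fin n) ℝ) (hP : P = D⁻¹ * W)
    (c : Fin n → ℝ) (hc : ∀ i, 0 < c i ∧ c i ≤ 1)
    (C : Matrix (Fin n) (Fin n) ℝ) (hC : C = Matrix.diagonal c)
    (α : ℝ) (hα : 0 < α ∧ α < 1)
    (M : Matrix (Fin n) (Fin n) ℝ)
    (hM : M = (α • (1 : Matrix (Fin n) (Fin n) ℝ) + (1-α) • C)⁻¹ * (α • P))
    (i j : Fin n) (hij : i ≠ j) (hedge : 0 < W i j) :
    (-1 : ℂ) ∉ spectrum ℂ ((Umat n M i j * Omat n i j).map Complex.ofReal) ∧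
    IsUnit (1 + Umat n M i j * Omat n i j) := by
  have hs (a : Fin n) : 0 < (1 - α) * c a := mul_pos (by linarith) (hc a).1
  have hsne (a : Fin n) : α + (1 - α) * c a ≠ 0 := (add_pos hα.1 (hs a)).ne'
  have hdeg (a : Fin n) : 0 < ∑ k, W a k := by
    have : Nontrivial (Fin n) := ⟨i, j, hij⟩
    obtain ⟨b, hb⟩ := hconn.preconnected.exists_adj_of_nontrivial a
    have hab : 0 < W a b := hb.2.elim id fun h => hWsymm a b ▸ h
    exact Finset.sum_pos' (fun k _ => hWnn a k) ⟨b, Finset.mem_univ b, hab⟩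
  have hentry (a b : Fin n) :
      M a b = α / (α + (1 - α) * c a) * (W a b / ∑ k, W a k) := by
    rw [hM, hP, hD, hC]
    exact inv_mul_smul_inv_mul_apply W c α hsne (fun a => (hdeg a).ne') a b
  have hdiag (a : Fin n) : M a a = 0 := by simp [hentry, hWdiag]
  have hnn (a b : Fin n) : 0 ≤ M a b := by
    rw [hentry]
    exact mul_nonneg (div_nonneg hα.1.le (add_pos hα.1 (hs a)).le)
      (div_nonneg (hWnn a b) (hdeg a).le)
  have hlt (a b : Fin n) : M a b < 1 := by
    rw [hentry]
    refine mul_lt_one_of_nonneg_of_lt_one_left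
      (div_nonneg hα.1.le (add_pos hα.1 (hs a)).le) ?_ ?_
    · rw [div_lt_one (add_pos hα.1 (hs a))]
      linarith [hs a]
    · rw [div_le_one (hdeg a)]
      exact Finset.single_le_sum (fun k _ => hWnn a k) (Finset.mem_univ b)
  have hunit := isUnit_one_add_Umat_mul_Omat M hij (hdiag i) (hdiag j)
    (mul_lt_one_of_nonneg_of_lt_one_left (hnn i j) (hlt i j) (hlt j i).le).ne
  exact ⟨neg_one_notMem_spectrum_map_ofReal hunit, hunit⟩
end

section
/- Assuming I − Ā is invertible, the matrix x = (I − Ā)⁻¹ b̄ ∈ ℝ^{n²×p} satisfies: for all i,j ∈ {1,…,n}, row (i−1)n + j of x equals row j of Θ* = ᾱ (I − ᾱ(I − C) − αP)⁻¹ C Θ^loc whenever (i,j) ∈ E or i = j, and row (i−1)n + j of x is zero otherwise. -/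
open Matrix Finset

/-- The diagonal matrix `I^E` with entry `(i,j)` equal to 1 if `(i,j) ∈ E` or `i = j`,
and 0 otherwise (edges are the pairs with `W i j > 0`). -/
noncomputable def IEmat (n : ℕ) (W : Matrix (Fin n) (Fin n) ℝ) :
    Matrix (Fin n × Fin n) (Fin n × Fin n) ℝ :=
  Matrix.diagonal fun q => if 0 < W q.1 q.2 ∨ q.1 = q.2 then 1 else 0

/-- Unlike `Matrix.vecMulVec_zero`, this allows the two vectors to have different index types. -/
theorem vecMulVec_zero_right {m l : Type*} (w : m → ℝ) :
    Matrix.vecMulVec w (0 : l → ℝ) = 0 := by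
  ext
  simp [Matrix.vecMulVec_apply]

theorem eVec_vecMul {n p : ℕ} (i j : Fin n) (v : Matrix (Fin n × Fin n) (Fin p) ℝ) :
    eVec n i j ᵥ* v = v (i, j) := by
  ext k
  simp [Matrix.vecMul, dotProduct, eVec]

/-- The communication step fixes any matrix whose rows `(i,j)` and `(j,j)`, and `(j,i)` and
`(i,i)`, agree. -/
theorem Omat_mul_eq_self {n p : ℕ} {i j : Fin n} {v : Matrix (Fin n × Fin n) (Fin p) ℝ}
    (hij : v (i, j) = v (j, j)) (hji : v (j, i) = v (i, i)) : Omat n i j * v = v := by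
  simp [Omat, Matrix.add_mul, Matrix.vecMulVec_mul, Matrix.sub_vecMul, eVec_vecMul, hij, hji,
    vecMulVec_zero_right]

theorem blockDiag_mul_apply {n p : ℕ} (M : Matrix (Fin n) (Fin n) ℝ)
    (v : Matrix (Fin n × Fin n) (Fin p) ℝ) (q : Fin n × Fin n) (k : Fin p) :
    (_root_.blockDiag n M * v) q k = ∑ l, M q.2 l * v (q.1, l) k := by
  simp [Matrix.mul_apply, _root_.blockDiag, Fintype.sum_prod_type, ite_mul, Finset.sum_ite_irrel]

theorem blockDiag_diagonal {n : ℕ} (a : Fin n → ℝ) :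
    _root_.blockDiag n (Matrix.diagonal a) = Matrix.diagonal fun q => a q.2 := by
  ext ⟨q₁, q₂⟩ ⟨r₁, r₂⟩
  by_cases h₁ : q₁ = r₁ <;> by_cases h₂ : q₂ = r₂ <;>
    simp [_root_.blockDiag, Matrix.diagonal_apply, h₁, h₂]

theorem inv_diagonal_of_ne_zero {m : Type*} [Fintype m] [DecidableEq m] {a : m → ℝ}
    (ha : ∀ i, a i ≠ 0) : (Matrix.diagonal a)⁻¹ = Matrix.diagonal fun i => (a i)⁻¹ := by
  refine Matrix.inv_eq_right_inv ?_
  simp [Matrix.diagonal_mul_diagonal, ha]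

/-- The matrix whose row `(i,j)` is row `j` of `Θ` if `(i,j)` is an edge or `i = j`, and zero
otherwise. -/
noncomputable def edgeStack {n p : ℕ} (W : Matrix (Fin n) (Fin n) ℝ)
    (Θ : Matrix (Fin n) (Fin p) ℝ) : Matrix (Fin n × Fin n) (Fin p) ℝ :=
  Matrix.of fun q => if 0 < W q.1 q.2 ∨ q.1 = q.2 then Θ q.2 else 0

theorem IEmat_mul_edgeStack {n p : ℕ} (W : Matrix (Fin n) (Fin n) ℝ)
    (Θ : Matrix (Fin n) (Fin p) ℝ) : IEmat n W * edgeStack W Θ = edgeStack W Θ := by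
  ext q k
  by_cases h : 0 < W q.1 q.2 ∨ q.1 = q.2 <;> simp [IEmat, edgeStack, Matrix.diagonal_mul, h]

theorem IEmat_mul_vecMulVec_eVec {n : ℕ} (W : Matrix (Fin n) (Fin n) ℝ) (i : Fin n)
    (w : Fin n × Fin n → ℝ) :
    IEmat n W * Matrix.vecMulVec (eVec n i i) w = Matrix.vecMulVec (eVec n i i) w := by
  ext q r
  by_cases h : q = (i, i) <;> simp [IEmat, Matrix.vecMulVec_apply, eVec, h]

/-- One averaging step over a sampled pair fixes `Y`, so `Y` solves the averaged fixed-point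
equation. -/
theorem average_fixed_point {n : ℕ} {m l : Type*} [Fintype m] (hn : n ≠ 0)
    (π : Fin n → Fin n → ℝ) (hπdiag : ∀ i, π i i = 0) (hπsum : ∀ i, ∑ j, π i j = 1)
    (J : Matrix m m ℝ) (T : Fin n → Fin n → Matrix m m ℝ) (u : Fin n → Fin n → Matrix m l ℝ)
    (Y : Matrix m l ℝ) (hstep : ∀ i j, π i j ≠ 0 → J * (T i j * Y) + u i j = Y) :
    ((1 / (n : ℝ)) • (J * ∑ i, ∑ j, if i = j then 0 else π i j • T i j)) * Y +
      (1 / (n : ℝ)) • (∑ i, ∑ j, if i = j then 0 else π i j • u i j) = Y := by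
  have hterm : ∀ i j, J * ((if i = j then 0 else π i j • T i j) * Y) +
      (if i = j then 0 else π i j • u i j) = π i j • Y := by
    intro i j
    by_cases hij : i = j
    · subst hij
      simp [hπdiag]
    by_cases h : π i j = 0
    · simp [h]
    · simp only [if_neg hij, Matrix.smul_mul, Matrix.mul_smul]
      rw [← smul_add, hstep i j h]
  have hn' : (n : ℝ) ≠ 0 := Nat.cast_ne_zero.mpr hn
  simp only [Matrix.smul_mul, Matrix.mul_assoc, Matrix.sum_mul, Matrix.mul_sum]
  rw [← smul_add, ← Finset.sum_add_distrib]
  simp_rw [← Finset.sum_add_distrib, hterm, ← Finset.sum_smul, hπsum]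
  rw [smul_smul]
  simp [hn']

/-- Assuming `I − Ā` is invertible, the matrix `x = (I − Ā)⁻¹ b̄` satisfies:
for all `i, j`, row `(i,j)` of `x` equals row `j` of `Θ* = ᾱ(I − ᾱ(I−C) − αP)⁻¹ C Θ^loc`
whenever `(i,j) ∈ E` or `i = j`, and row `(i,j)` of `x` is zero otherwise. -/
theorem fixed_point_rows_are_optimal_models
    (n p : ℕ) (hn : 2 ≤ n) (hp : 1 ≤ p)
    (W : Matrix (Fin n) (Fin n) ℝ)
    (hWsymm : ∀ i j, W i j = W j i)
    (hWnn : ∀ i j, 0 ≤ W i j)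
    (hWdiag : ∀ i, W i i = 0)
    (hconn : (SimpleGraph.fromRel (fun i j => 0 < W i j)).Connected)
    (D : Matrix (Fin n) (Fin n) ℝ)
    (hD : D = Matrix.diagonal (fun i => ∑ j, W i j))
    (P : Matrix (Fin n) (Fin n) ℝ) (hP : P = D⁻¹ * W)
    (c : Fin n → ℝ) (hc : ∀ i, 0 < c i ∧ c i ≤ 1)
    (C : Matrix (Fin n) (Fin n) ℝ) (hC : C = Matrix.diagonal c)
    (α : ℝ) (hα : 0 < α ∧ α < 1)
    (Θloc : Matrix (Fin n) (Fin p) ℝ)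
    (M : Matrix (Fin n) (Fin n) ℝ)
    (hM : M = (α • (1 : Matrix (Fin n) (Fin n) ℝ) + (1-α) • C)⁻¹ * (α • P))
    (π : Fin n → Fin n → ℝ)
    (hπnn : ∀ i j, 0 ≤ π i j)
    (hπsum : ∀ i, ∑ j, π i j = 1)
    (hπpos : ∀ i j, 0 < π i j ↔ 0 < W i j)
    (Abar : Matrix (Fin n × Fin n) (Fin n × Fin n) ℝ)
    (hAbar : Abar = (1/(n:ℝ)) •
      (IEmat n W * ∑ i, ∑ j, if i = j then 0 else π i j • (Umat n M i j * Omat n i j)))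
    -- vertical stacking of n copies of Θ^loc
    (Θblk : Matrix (Fin n × Fin n) (Fin p) ℝ) (hΘblk : Θblk = Matrix.of fun q => Θloc q.2)
    -- u(i,j) = (e_i^i(e_i^i)ᵀ + e_j^j(e_j^j)ᵀ) A_blk⁻¹ ᾱ C_blk Θ̃^loc
    (u : Fin n → Fin n → Matrix (Fin n × Fin n) (Fin p) ℝ)
    (hu : ∀ i j, u i j =
      (Matrix.vecMulVec (eVec n i i) (eVec n i i) + Matrix.vecMulVec (eVec n j j) (eVec n j j)) *
        ((blockDiag n (α • (1 : Matrix (Fin n) (Fin n) ℝ) + (1-α) • C))⁻¹ *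
          ((1-α) • (blockDiag n C * Θblk))))
    (bbar : Matrix (Fin n × Fin n) (Fin p) ℝ)
    (hbbar : bbar = (1/(n:ℝ)) • ∑ i, ∑ j, if i = j then 0 else π i j • u i j)
    (Θstar : Matrix (Fin n) (Fin p) ℝ)
    (hΘstar : Θstar =
      (1-α) • ((1 - (1-α) • ((1 : Matrix (Fin n) (Fin n) ℝ) - C) - α • P)⁻¹ * C * Θloc))
    (hinv : IsUnit (1 - Abar)) :
    ∀ i j : Fin n,
      ((0 < W i j ∨ i = j) → ((1 - Abar)⁻¹ * bbar) (i, j) = Θstar j) ∧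
      (¬(0 < W i j ∨ i = j) → ((1 - Abar)⁻¹ * bbar) (i, j) = 0) := by
  have hα0 := hα.1
  have hα1 : 0 < 1 - α := sub_pos.mpr hα.2
  have hπ0 : ∀ i j, π i j ≠ 0 → 0 < W i j := fun i j h =>
    (hπpos i j).1 ((hπnn i j).lt_of_ne' h)
  have hπdiag : ∀ i, π i i = 0 := fun i => by
    by_contra h
    exact (hπ0 i i h).ne' (hWdiag i)
  have hdeg : ∀ i, 0 < ∑ j, W i j := fun i => by
    obtain ⟨j, -, hj⟩ := Finset.exists_ne_zero_of_sum_ne_zero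
      (show ∑ j, π i j ≠ 0 by simp [hπsum i])
    exact Finset.sum_pos' (fun j _ => hWnn i j) ⟨j, Finset.mem_univ j, hπ0 i j hj⟩
  set a : Fin n → ℝ := fun i => α + (1 - α) * c i with ha
  have hapos : ∀ i, 0 < a i := fun i => by
    have := mul_pos hα1 (hc i).1
    simp only [ha]
    linarith
  have hA : α • (1 : Matrix (Fin n) (Fin n) ℝ) + (1 - α) • C = Matrix.diagonal a := by
    ext i j
    by_cases h : i = j <;> simp [hC, ha, h]
  have hPapp : ∀ i j, P i j = (∑ l, W i l)⁻¹ * W i j := fun i j => by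
    rw [hP, hD, inv_diagonal_of_ne_zero fun i => (hdeg i).ne', Matrix.diagonal_mul]
  have hN : 1 - (1 - α) • ((1 : Matrix (Fin n) (Fin n) ℝ) - C) - α • P =
      Matrix.diagonal a - α • P := by
    rw [← hA]
    module
  have hNapp : ∀ i j, i ≠ j → (Matrix.diagonal a - α • P) i j = -(α * P i j) := fun i j h => by
    simp [h]
  have hPdiag : ∀ i, P i i = 0 := fun i => by simp [hPapp, hWdiag]
  have hNdet : IsUnit (Matrix.diagonal a - α • P).det := by
    refine isUnit_iff_ne_zero.mpr (det_ne_zero_of_sum_row_lt_diag fun i => ?_)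
    have hPnn : ∀ j, 0 ≤ P i j := fun j => by
      rw [hPapp]
      exact mul_nonneg (inv_nonneg.mpr (hdeg i).le) (hWnn i j)
    have hPsum : ∑ j, P i j = 1 := by
      simp_rw [hPapp, ← Finset.mul_sum]
      exact inv_mul_cancel₀ (hdeg i).ne'
    calc ∑ j ∈ Finset.univ.erase i, ‖(Matrix.diagonal a - α • P) i j‖
        = ∑ j ∈ Finset.univ.erase i, α * P i j := by
          refine Finset.sum_congr rfl fun j hj => ?_
          rw [hNapp i j (Finset.ne_of_mem_erase hj).symm, norm_neg, Real.norm_eq_abs,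
            abs_of_nonneg (mul_nonneg hα0.le (hPnn j))]
      _ ≤ ∑ j, α * P i j := Finset.sum_le_sum_of_subset_of_nonneg (Finset.erase_subset _ _)
          fun j _ _ => mul_nonneg hα0.le (hPnn j)
      _ = α := by rw [← Finset.mul_sum, hPsum, mul_one]
      _ < a i := by
          have := mul_pos hα1 (hc i).1
          simp only [ha]
          linarith
      _ = ‖(Matrix.diagonal a - α • P) i i‖ := by
          simp [hPdiag, abs_of_pos (hapos i)]
  have hΘeq : (Matrix.diagonal a - α • P) * Θstar = (1 - α) • (C * Θloc) := by
    rw [hΘstar, hN, Matrix.mul_smul, Matrix.mul_assoc, Matrix.mul_nonsing_inv_cancel_left _ _ hNdet]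
  have hΘrow : ∀ i k, a i * Θstar i k =
      α * ∑ l, P i l * Θstar l k + (1 - α) * (c i * Θloc i k) := fun i k => by
    have h := congrFun (congrFun hΘeq i) k
    rw [Matrix.sub_mul, Matrix.sub_apply, Matrix.diagonal_mul, hC, Matrix.smul_mul,
      Matrix.smul_apply, Matrix.smul_apply, Matrix.diagonal_mul, Matrix.mul_apply, smul_eq_mul,
      smul_eq_mul] at h
    linarith
  have hMapp : ∀ i l, M i l = (a i)⁻¹ * (α * P i l) := fun i l => by
    rw [hM, hA, inv_diagonal_of_ne_zero fun i => (hapos i).ne', Matrix.diagonal_mul,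
      Matrix.smul_apply, smul_eq_mul]
  set r : Matrix (Fin n × Fin n) (Fin p) ℝ :=
    (_root_.blockDiag n (α • (1 : Matrix (Fin n) (Fin n) ℝ) + (1 - α) • C))⁻¹ *
      ((1 - α) • (_root_.blockDiag n C * Θblk)) with hr
  have hrapp : ∀ i k, r (i, i) k = (a i)⁻¹ * ((1 - α) * (c i * Θloc i k)) := fun i k => by
    rw [hr, hA, hC, blockDiag_diagonal, blockDiag_diagonal,
      inv_diagonal_of_ne_zero fun q : Fin n × Fin n => (hapos q.2).ne', Matrix.diagonal_mul,
      Matrix.smul_apply, Matrix.diagonal_mul, hΘblk, smul_eq_mul, Matrix.of_apply]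
  clear_value r
  have hrow : ∀ i, ((_root_.blockDiag n M - 1) * edgeStack W Θstar + r :
      Matrix (Fin n × Fin n) (Fin p) ℝ) (i, i) = 0 := fun i => by
    ext k
    have hsum : ∑ l, M i l * edgeStack W Θstar (i, l) k =
        (a i)⁻¹ * (α * ∑ l, P i l * Θstar l k) := by
      rw [Finset.mul_sum, Finset.mul_sum]
      refine Finset.sum_congr rfl fun l _ => ?_
      rw [hMapp]
      by_cases h : 0 < W i l
      · simp only [edgeStack, Matrix.of_apply, h, true_or, if_true]
        ring
      · simp [hPapp, le_antisymm (not_lt.mp h) (hWnn i l)]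
    rw [Matrix.add_apply, Matrix.sub_mul, Matrix.sub_apply, blockDiag_mul_apply, hsum, hrapp,
      Matrix.one_mul, show edgeStack W Θstar (i, i) k = Θstar i k by simp [edgeStack]]
    have := (hapos i).ne'
    have h := hΘrow i k
    simp only [Pi.zero_apply]
    field_simp
    linarith
  have hstep : ∀ i j, π i j ≠ 0 →
      IEmat n W * (Umat n M i j * Omat n i j * edgeStack W Θstar) + u i j =
        edgeStack W Θstar := by
    intro i j h
    have hij := hπ0 i j h
    have hji : 0 < W j i := hWsymm i j ▸ hij
    have hO : Omat n i j * edgeStack W Θstar = edgeStack W Θstar :=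
      Omat_mul_eq_self (funext fun k => by simp [edgeStack, hij])
        (funext fun k => by simp [edgeStack, hji])
    have hIu : u i j = IEmat n W * u i j := by
      rw [hu, ← Matrix.mul_assoc, Matrix.mul_add, IEmat_mul_vecMulVec_eVec,
        IEmat_mul_vecMulVec_eVec]
    have hU : Umat n M i j * edgeStack W Θstar + u i j = edgeStack W Θstar := by
      rw [hu, Umat, Matrix.add_mul, Matrix.one_mul, Matrix.mul_assoc, add_assoc, ← Matrix.mul_add,
        Matrix.add_mul, Matrix.vecMulVec_mul, Matrix.vecMulVec_mul, eVec_vecMul, eVec_vecMul,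
        hrow, hrow, vecMulVec_zero_right, vecMulVec_zero_right, add_zero, add_zero]
    rw [Matrix.mul_assoc, hO, hIu, ← Matrix.mul_add, hU, IEmat_mul_edgeStack]
  have hfix := average_fixed_point (by omega) π hπdiag hπsum (IEmat n W)
    (fun i j => Umat n M i j * Omat n i j) u (edgeStack W Θstar) hstep
  rw [← hAbar, ← hbbar] at hfix
  have hsol : (1 - Abar)⁻¹ * bbar = edgeStack W Θstar := by
    rw [show bbar = (1 - Abar) * edgeStack W Θstar by
      rw [Matrix.sub_mul, Matrix.one_mul, eq_sub_iff_add_eq, add_comm, hfix]]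
    exact Matrix.nonsing_inv_mul_cancel_left _ _ ((Matrix.isUnit_iff_isUnit_det _).1 hinv)
  intro i j
  rw [hsol]
  exact ⟨fun h => if_pos h, fun h => if_neg h⟩
end
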